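/- One-sided Multistep Interleave: Assume step is closed under framing. Let σ : Ω₁@T₁ ⟹ Ω₁'@T₁' and σ' : Ω₂@T₂ ⟹ Ω₂'@T₂' be timed multistep derivations. Then: (i) if T₁ ≤ T₂, there is a derivation ⋈_L(σ,σ') : (Ω₁ ⊎ Ω₂)@T₁ ⟹ (Ω₁' ⊎ Ω₂')@max(T₁',T₂'); and (ii) if T₂ ≤ T₁, there is a derivation ⋈_R(σ,σ') : (Ω₁ ⊎ Ω₂)@T₂ ⟹ (Ω₁' ⊎ Ω₂')@max(T₁',T₂'). -/

import Mathlib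

/-- Configurations: finite multisets of atomic objects. -/
abbrev Cfg (A : Type*) := Multiset A

/-- Timed multistep derivations `Ω@T ⟹ Ω'@T'` (proof-relevant). -/
inductive MultiStep {A : Type*} {FinTime : Type*} [LinearOrder FinTime]
    (step : Cfg A → FinTime → Cfg A → Prop) :
    Cfg A → FinTime → Cfg A → FinTime → Type _ where
  | refl (Ω : Cfg A) (T : FinTime) : MultiStep step Ω T Ω T
  | stepT {Ω Ω' : Cfg A} {T₁ T₂ T₃ : FinTime} (h : T₁ ≤ T₂)
      (σ : MultiStep step Ω T₂ Ω' T₃) : MultiStep step Ω T₁ Ω' T₃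
  | stepC {Ω Ω' Ω'' : Cfg A} {T₁ T₂ : FinTime} (h : step Ω T₁ Ω')
      (σ : MultiStep step Ω' T₁ Ω'' T₂) : MultiStep step Ω T₁ Ω'' T₂

theorem MultiStep.time_le {A : Type*} {FinTime : Type*} [LinearOrder FinTime]
    {step : Cfg A → FinTime → Cfg A → Prop} {Ω Ω' : Cfg A} {T T' : FinTime}
    (σ : MultiStep step Ω T Ω' T') : T ≤ T' := by
  induction σ with
  | refl => exact le_rfl
  | stepT h _ ih => exact h.trans ih
  | stepC _ _ ih => exact ih

theorem MultiStep.frame {A : Type*} {FinTime : Type*} [LinearOrder FinTime]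
    {step : Cfg A → FinTime → Cfg A → Prop}
    (hframe : ∀ (Ω : Cfg A) (T : FinTime) (Ω' Ω₀ : Cfg A),
      step Ω T Ω' → step (Ω + Ω₀) T (Ω' + Ω₀))
    {Ω Ω' : Cfg A} {T T' : FinTime}
    (σ : MultiStep step Ω T Ω' T') (Ω₀ : Cfg A) :
    Nonempty (MultiStep step (Ω + Ω₀) T (Ω' + Ω₀) T') := by
  induction σ with
  | refl => exact ⟨.refl _ _⟩
  | stepT h _ ih => exact ih.map (.stepT h)
  | stepC h _ ih => exact ih.map (.stepC (hframe _ _ _ _ h))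

/-- The right-sided claim for a fixed `σ`, given the left-sided claim for it. -/
theorem MultiStep.right_of_left {A : Type*} {FinTime : Type*} [LinearOrder FinTime]
    {step : Cfg A → FinTime → Cfg A → Prop}
    (hframe : ∀ (Ω : Cfg A) (T : FinTime) (Ω' Ω₀ : Cfg A),
      step Ω T Ω' → step (Ω + Ω₀) T (Ω' + Ω₀))
    {Ω₁ Ω₁' : Cfg A} {T₁ T₁' : FinTime}
    (σ : MultiStep step Ω₁ T₁ Ω₁' T₁')
    (hl : ∀ {Ω₂ Ω₂' : Cfg A} {T₂ T₂' : FinTime}, MultiStep step Ω₂ T₂ Ω₂' T₂' → T₁ ≤ T₂ →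
      Nonempty (MultiStep step (Ω₁ + Ω₂) T₁ (Ω₁' + Ω₂') (max T₁' T₂')))
    {Ω₂ Ω₂' : Cfg A} {T₂ T₂' : FinTime} (σ' : MultiStep step Ω₂ T₂ Ω₂' T₂') (hT : T₂ ≤ T₁) :
    Nonempty (MultiStep step (Ω₁ + Ω₂) T₂ (Ω₁' + Ω₂') (max T₁' T₂')) := by
  induction σ' with
  | refl Ω T =>
    rw [max_eq_left (hT.trans σ.time_le)]
    exact (σ.frame hframe Ω).map (.stepT hT)
  | @stepT _ _ _ Tb _ h σ' ih =>
    rcases le_total Tb T₁ with hb | hb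
    · exact (ih hb).map (.stepT h)
    · exact (hl σ' hb).map (.stepT hT)
  | @stepC Ωa Ωb _ T _ h _ ih =>
    have h' : step (Ω₁ + Ωa) T (Ω₁ + Ωb) := by
      rw [add_comm Ω₁, add_comm Ω₁]
      exact hframe _ _ _ _ h
    exact (ih hT).map (.stepC h')

/-- The left-sided claim. -/
theorem MultiStep.left {A : Type*} {FinTime : Type*} [LinearOrder FinTime]
    {step : Cfg A → FinTime → Cfg A → Prop}
    (hframe : ∀ (Ω : Cfg A) (T : FinTime) (Ω' Ω₀ : Cfg A),
      step Ω T Ω' → step (Ω + Ω₀) T (Ω' + Ω₀))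
    {Ω₁ Ω₁' : Cfg A} {T₁ T₁' : FinTime}
    (σ : MultiStep step Ω₁ T₁ Ω₁' T₁') :
    ∀ {Ω₂ Ω₂' : Cfg A} {T₂ T₂' : FinTime}, MultiStep step Ω₂ T₂ Ω₂' T₂' → T₁ ≤ T₂ →
      Nonempty (MultiStep step (Ω₁ + Ω₂) T₁ (Ω₁' + Ω₂') (max T₁' T₂')) := by
  induction σ with
  | refl Ω T =>
    intro Ω₂ Ω₂' T₂ T₂' σ' hT
    rw [max_eq_right (hT.trans σ'.time_le), add_comm Ω, add_comm Ω]
    exact (σ'.frame hframe Ω).map (.stepT hT)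
  | @stepT _ _ _ Ta _ h σ ih =>
    intro Ω₂ Ω₂' T₂ T₂' σ' hT
    rcases le_total Ta T₂ with ha | ha
    · exact (ih σ' ha).map (.stepT h)
    · exact (σ.right_of_left hframe ih σ' ha).map (.stepT hT)
  | stepC h _ ih =>
    intro Ω₂ Ω₂' T₂ T₂' σ' hT
    exact (ih σ' hT).map (.stepC (hframe _ _ _ _ h))

/-- **One-sided Multistep Interleave**: assuming `step` is closed under framing,
given `σ : Ω₁@T₁ ⟹ Ω₁'@T₁'` and `σ' : Ω₂@T₂ ⟹ Ω₂'@T₂'`: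
(i) if `T₁ ≤ T₂` there is a derivation
`(Ω₁ ⊎ Ω₂)@T₁ ⟹ (Ω₁' ⊎ Ω₂')@max(T₁',T₂')`, and
(ii) if `T₂ ≤ T₁` there is a derivation
`(Ω₁ ⊎ Ω₂)@T₂ ⟹ (Ω₁' ⊎ Ω₂')@max(T₁',T₂')`. -/
theorem multistep_interleave_oneSided {A : Type*} {FinTime : Type*} [LinearOrder FinTime]
    (step : Cfg A → FinTime → Cfg A → Prop)
    (hframe : ∀ (Ω : Cfg A) (T : FinTime) (Ω' Ω₀ : Cfg A),
      step Ω T Ω' → step (Ω + Ω₀) T (Ω' + Ω₀))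
    {Ω₁ Ω₁' Ω₂ Ω₂' : Cfg A} {T₁ T₁' T₂ T₂' : FinTime}
    (σ : MultiStep step Ω₁ T₁ Ω₁' T₁') (σ' : MultiStep step Ω₂ T₂ Ω₂' T₂') :
    (T₁ ≤ T₂ →
      Nonempty (MultiStep step (Ω₁ + Ω₂) T₁ (Ω₁' + Ω₂') (max T₁' T₂'))) ∧
    (T₂ ≤ T₁ →
      Nonempty (MultiStep step (Ω₁ + Ω₂) T₂ (Ω₁' + Ω₂') (max T₁' T₂'))) := by
  exact ⟨σ.left hframe σ', σ.right_of_left hframe (σ.left hframe) σ'⟩
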